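/- There exist finitely many homeomorphisms f₁,…,fₙ of the circle S¹, each having a fixed point, such that some minimal set M of IFS(f₁,…,fₙ) is a symmetric Cantorval. -/

import Mathlib

open Set Topology Filter

/-- The circle. -/
abbrev S1 := AddCircle (1 : ℝ)

/-- Apply a word `l = [i₁, …, i_k]` of generators: `f i₁ ∘ ⋯ ∘ f i_k`. -/
def applyWord {X : Type*} {n : ℕ} (f : Fin n → X → X) (l : List (Fin n)) (x : X) : X :=
  l.foldr (fun i y => f i y) x

/-- The orbit of `x` under the semigroup `IFS(f₁,…,fₙ)` (nonempty words). -/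
def orbitIFS {X : Type*} {n : ℕ} (f : Fin n → X → X) (x : X) : Set X :=
  {y | ∃ l : List (Fin n), l ≠ [] ∧ y = applyWord f l x}

/-- `M` is a minimal set for the IFS generated by `f₁,…,fₙ`. -/
def IsMinimalIFS {X : Type*} [TopologicalSpace X] {n : ℕ} (f : Fin n → X → X)
    (M : Set X) : Prop :=
  M.Nonempty ∧ IsClosed M ∧ (∀ i, f i '' M ⊆ M) ∧
    ∀ x ∈ M, closure (orbitIFS f x) = M

/-- A Cantor set: nonempty, compact, perfect and totally disconnected. -/
def IsCantorSet {X : Type*} [TopologicalSpace X] (K : Set X) : Prop :=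
  K.Nonempty ∧ IsCompact K ∧ Perfect K ∧ IsTotallyDisconnected K

/-- `X` is (homeomorphic to) the circle or a (nondegenerate) closed interval. -/
def IsCircleOrInterval (X : Type*) [TopologicalSpace X] : Prop :=
  Nonempty (X ≃ₜ S1) ∨ ∃ a b : ℝ, a < b ∧ Nonempty (X ≃ₜ Set.Icc a b)

/-- The canonical decomposition `M = 𝓘 ∪ K ∪ N` of a closed set:
`𝓘` is the interior (union of components of the interior), `K` is the maximal
Cantor set contained in `M \ 𝓘` (possibly empty), and `N` is the countable remainder. -/
def IsCanonicalDecomp {X : Type*} [TopologicalSpace X] (M I K N : Set X) : Prop :=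
  I = interior M ∧
  (IsCantorSet K ∨ K = ∅) ∧
  K ⊆ M \ I ∧
  (∀ K₁ : Set X, IsCantorSet K₁ → K ⊆ K₁ → K₁ ⊆ M \ I → K₁ = K) ∧
  N = M \ (I ∪ K) ∧
  N.Countable

/-- A symmetric Cantorval: a nonempty compact set which is the closure of its interior,
and such that both endpoints of every nontrivial connected component are accumulation
points of one-point connected components. -/
def IsSymmetricCantorval {X : Type*} [TopologicalSpace X] (M : Set X) : Prop :=
  M.Nonempty ∧ IsCompact M ∧ M = closure (interior M) ∧
  ∀ x ∈ M, ¬ (connectedComponentIn M x).Subsingleton →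
    ∀ z ∈ frontier (connectedComponentIn M x),
      AccPt z (𝓟 {y | y ∈ M ∧ connectedComponentIn M y = {y}})


/-! ### Words and invariant sets -/

lemma applyWord_mem {X : Type*} {n : ℕ} {f : Fin n → X → X} {C : Set X}
    (hC : ∀ i, ∀ x ∈ C, f i x ∈ C) (l : List (Fin n)) {x : X} (hx : x ∈ C) :
    applyWord f l x ∈ C := by
  induction l with
  | nil => exact hx
  | cons i l ih => exact hC i _ ih

lemma orbitIFS_invariant {X : Type*} {n : ℕ} (f : Fin n → X → X) (x : X) (i : Fin n) :
    ∀ y ∈ orbitIFS f x, f i y ∈ orbitIFS f x := by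
  rintro _ ⟨l, -, rfl⟩
  exact ⟨i :: l, by simp, rfl⟩

lemma closure_orbitIFS_invariant {X : Type*} [TopologicalSpace X] {n : ℕ} {f : Fin n → X → X}
    (hf : ∀ i, Continuous (f i)) (x : X) (i : Fin n) :
    ∀ y ∈ closure (orbitIFS f x), f i y ∈ closure (orbitIFS f x) := fun _ hy =>
  map_mem_closure (hf i) hy (orbitIFS_invariant f x i)

lemma orbitIFS_semiconj {X Y : Type*} {n : ℕ} {f : Fin n → X → X} {g : Fin n → Y → Y}
    {e : X → Y} (h : ∀ i x, g i (e x) = e (f i x)) (x : X) :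
    orbitIFS g (e x) = e '' orbitIFS f x := by
  have key (l : List (Fin n)) : applyWord g l (e x) = e (applyWord f l x) := by
    induction l with
    | nil => rfl
    | cons i l ih => exact (congrArg (g i) ih).trans (h i _)
  ext y
  constructor
  · rintro ⟨l, hl, rfl⟩
    exact ⟨_, ⟨l, hl, rfl⟩, (key l).symm⟩
  · rintro ⟨_, ⟨l, hl, rfl⟩, rfl⟩
    exact ⟨l, hl, (key l).symm⟩

/-- Minimal sets that are compact are transported by continuous semiconjugacies. -/
lemma IsMinimalIFS.image {X Y : Type*} [TopologicalSpace X] [TopologicalSpace Y] [T2Space Y]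
    {n : ℕ} {f : Fin n → X → X} {g : Fin n → Y → Y} {e : X → Y} (he : Continuous e)
    (h : ∀ i x, g i (e x) = e (f i x)) {M : Set X} (hM : IsMinimalIFS f M) (hc : IsCompact M) :
    IsMinimalIFS g (e '' M) := by
  obtain ⟨hne, -, hinv, hmin⟩ := hM
  refine ⟨hne.image e, (hc.image he).isClosed, fun i => ?_, ?_⟩
  · rintro _ ⟨_, ⟨x, hx, rfl⟩, rfl⟩
    exact ⟨f i x, hinv i ⟨x, hx, rfl⟩, (h i x).symm⟩
  · rintro _ ⟨x, hx, rfl⟩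
    rw [orbitIFS_semiconj h, ← image_closure_of_isCompact (by rwa [hmin x hx]) he.continuousOn,
      hmin x hx]

/-! ### Transport of Cantorvals along open embeddings -/

lemma connectedComponentIn_image_of_isEmbedding {X Y : Type*} [TopologicalSpace X]
    [TopologicalSpace Y] {e : X → Y} (he : IsEmbedding e) {M : Set X} {x : X} (hx : x ∈ M) :
    connectedComponentIn (e '' M) (e x) = e '' connectedComponentIn M x := by
  refine Subset.antisymm ?_ (he.continuous.continuousOn.image_connectedComponentIn_subset hx)
  obtain ⟨t, ht, hte⟩ := subset_image_iff.1 (connectedComponentIn_subset (e '' M) (e x))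
  have hpre : IsPreconnected t := by
    rw [← he.isInducing.isPreconnected_image, hte]
    exact isPreconnected_connectedComponentIn
  have hxt : x ∈ t := by
    have : e x ∈ e '' t := hte ▸ mem_connectedComponentIn (mem_image_of_mem e hx)
    exact (he.injective.mem_set_image).1 this
  rw [← hte]
  exact image_mono (hpre.subset_connectedComponentIn hxt ht)

lemma IsSymmetricCantorval.image {X Y : Type*} [TopologicalSpace X] [TopologicalSpace Y]
    [T2Space Y] {e : X → Y} (he : IsOpenEmbedding e) {M : Set X} (hM : IsSymmetricCantorval M) :
    IsSymmetricCantorval (e '' M) := by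
  obtain ⟨hne, hc, hcl, hcomp⟩ := hM
  have hc' := hc.image he.continuous
  refine ⟨hne.image e, hc', Subset.antisymm ?_ ?_, ?_⟩
  · calc e '' M ⊆ e '' closure (interior M) := image_mono hcl.subset
      _ ⊆ closure (e '' interior M) := image_closure_subset_closure_image he.continuous
      _ ⊆ closure (interior (e '' M)) := closure_mono
          (interior_maximal (image_mono interior_subset) (he.isOpenMap _ isOpen_interior))
  · exact hc'.isClosed.closure_subset_iff.2 interior_subset
  · rintro _ ⟨x, hx, rfl⟩ hnt z hz
    rw [connectedComponentIn_image_of_isEmbedding he.isEmbedding hx] at hnt hz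
    set C := connectedComponentIn M x with hC
    have hzM : z ∈ e '' M := by
      refine closure_minimal (image_mono ?_) hc'.isClosed hz.1
      exact connectedComponentIn_subset M x
    obtain ⟨w, hw, rfl⟩ := hzM
    have hwC : w ∈ frontier C := by
      refine ⟨?_, fun hi => hz.2 ?_⟩
      · have := hz.1
        rwa [← mem_preimage, he.isOpenMap.preimage_closure_eq_closure_preimage he.continuous,
          preimage_image_eq _ he.injective] at this
      · exact interior_maximal (image_mono interior_subset) (he.isOpenMap _ isOpen_interior)
          (mem_image_of_mem e hi)
    have hacc := hcomp x hx (fun hs => hnt (hs.image e)) w hwC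
    have hmap := hacc.map he.continuous.continuousAt he.injective
    refine hmap.mono ?_
    rw [map_principal, principal_mono]
    rintro _ ⟨y, ⟨hy, hys⟩, rfl⟩
    refine ⟨mem_image_of_mem e hy, ?_⟩
    rw [connectedComponentIn_image_of_isEmbedding he.isEmbedding hy, hys, image_singleton]

/-! ### The Guthrie–Nymann Cantorval -/

/-- The digits of the Guthrie–Nymann Cantorval. -/
def gnDigit : Fin 4 → ℤ := ![0, 2, 3, 5]

/-- The contraction `x ↦ (x + d) / 4` attached to the `i`-th digit `d`. -/
noncomputable def gnMap (i : Fin 4) : ℝ ≃ₜ ℝ :=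
  (Homeomorph.addRight (gnDigit i : ℝ)).trans (Homeomorph.mulRight₀ (4⁻¹ : ℝ) (by norm_num))

lemma gnMap_apply (i : Fin 4) (x : ℝ) : gnMap i x = (x + gnDigit i) / 4 := by
  simp [gnMap, div_eq_mul_inv]

/-- The Guthrie–Nymann Cantorval, as the closure of the orbit of the fixed point `0`. -/
def gnSet : Set ℝ := closure (orbitIFS (fun i x => gnMap i x) 0)

lemma gnDigit_rev (i : Fin 4) : gnDigit i.rev = 5 - gnDigit i := by
  fin_cases i <;> rfl

lemma gnDigit_nonneg (i : Fin 4) : (0 : ℝ) ≤ gnDigit i := by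
  fin_cases i <;> simp [gnDigit]

lemma gnDigit_le (i : Fin 4) : (gnDigit i : ℝ) ≤ 5 := by
  fin_cases i <;> norm_num [gnDigit]

lemma isClosed_gnSet : IsClosed gnSet := isClosed_closure

lemma gnSet_subset_Icc : gnSet ⊆ Icc 0 (5 / 3) := by
  refine closure_minimal ?_ isClosed_Icc
  rintro _ ⟨l, -, rfl⟩
  refine applyWord_mem (fun i x hx => ?_) l (by norm_num)
  have h₀ := gnDigit_nonneg i
  have h₁ := gnDigit_le i
  rw [gnMap_apply]
  constructor <;> linarith [hx.1, hx.2]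

lemma isCompact_gnSet : IsCompact gnSet :=
  isCompact_Icc.of_isClosed_subset isClosed_gnSet gnSet_subset_Icc

lemma gnMap_mem {x : ℝ} (hx : x ∈ gnSet) (i : Fin 4) : gnMap i x ∈ gnSet :=
  closure_orbitIFS_invariant (fun i => (gnMap i).continuous) 0 i x hx

lemma zero_mem_gnSet : (0 : ℝ) ∈ gnSet :=
  subset_closure ⟨[0], by simp, by simp [applyWord, gnMap_apply, gnDigit]⟩

lemma exists_gnMap_eq {x : ℝ} (hx : x ∈ gnSet) : ∃ i, ∃ y ∈ gnSet, gnMap i y = x := by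
  have hcl : IsClosed (⋃ i, gnMap i '' gnSet) :=
    isClosed_iUnion_of_finite fun i => (gnMap i).isClosedMap _ isClosed_gnSet
  have hsub : gnSet ⊆ ⋃ i, gnMap i '' gnSet := by
    refine closure_minimal ?_ hcl
    rintro _ ⟨l, hl, rfl⟩
    obtain ⟨i, l, rfl⟩ := List.exists_cons_of_ne_nil hl
    exact mem_iUnion.2 ⟨i, _, applyWord_mem (fun i x hx => gnMap_mem hx i) l zero_mem_gnSet, rfl⟩
  obtain ⟨i, y, hy, rfl⟩ := mem_iUnion.1 (hsub hx)
  exact ⟨i, y, hy, rfl⟩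

lemma five_thirds_mem_gnSet : (5 / 3 : ℝ) ∈ gnSet := by
  obtain ⟨s, hs, hmax⟩ := isCompact_gnSet.exists_isGreatest ⟨0, zero_mem_gnSet⟩
  have h := hmax (gnMap_mem hs 3)
  have h' := (gnSet_subset_Icc hs).2
  rw [gnMap_apply] at h
  have h₃ : (gnDigit 3 : ℝ) = 5 := by simp [gnDigit]
  rw [h₃] at h
  rwa [show (5 / 3 : ℝ) = s by linarith]

lemma reflect_mem_gnSet {x : ℝ} (hx : x ∈ gnSet) : 5 / 3 - x ∈ gnSet := by
  have key (l : List (Fin 4)) : 5 / 3 - applyWord (fun i x => gnMap i x) l 0 ∈ gnSet := by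
    induction l with
    | nil => simpa [applyWord] using five_thirds_mem_gnSet
    | cons i l ih =>
      convert gnMap_mem ih i.rev using 1
      simp only [applyWord, List.foldr_cons, gnMap_apply, gnDigit_rev]
      push_cast
      ring
  have hsub : gnSet ⊆ (fun x => 5 / 3 - x) ⁻¹' gnSet := by
    refine closure_minimal ?_ (isClosed_gnSet.preimage (by fun_prop))
    rintro _ ⟨l, -, rfl⟩
    exact key l
  exact hsub hx

lemma reflect_mem_gnSet_iff {x : ℝ} : 5 / 3 - x ∈ gnSet ↔ x ∈ gnSet :=
  ⟨fun h => by simpa using reflect_mem_gnSet h, reflect_mem_gnSet⟩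

lemma isMinimalIFS_gnSet : IsMinimalIFS (fun i x => gnMap i x) gnSet := by
  refine ⟨⟨0, zero_mem_gnSet⟩, isClosed_gnSet, ?_, fun x hx => Subset.antisymm ?_ ?_⟩
  · rintro i _ ⟨x, hx, rfl⟩
    exact gnMap_mem hx i
  · refine closure_minimal ?_ isClosed_gnSet
    rintro _ ⟨l, -, rfl⟩
    exact applyWord_mem (fun i x hx => gnMap_mem hx i) l hx
  · have hinv := closure_orbitIFS_invariant (f := fun i x => gnMap i x)
      (fun i => (gnMap i).continuous) x
    have h₀ : (0 : ℝ) ∈ closure (orbitIFS (fun i x => gnMap i x) x) := by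
      have hw (n : ℕ) : applyWord (fun i x => gnMap i x) (List.replicate n 0) x
          = x * (1 / 4) ^ n := by
        induction n with
        | zero => simp [applyWord]
        | succ n ih =>
          rw [applyWord] at ih
          rw [applyWord, List.replicate_succ, List.foldr_cons, ih, gnMap_apply]
          simp only [gnDigit, Matrix.cons_val_zero, Int.cast_zero]
          ring
      have hlim : Tendsto (fun n : ℕ => x * (1 / 4 : ℝ) ^ (n + 1)) atTop (𝓝 0) := by
        simpa using ((tendsto_pow_atTop_nhds_zero_of_lt_one (by norm_num : (0 : ℝ) ≤ 1 / 4)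
          (by norm_num)).comp (tendsto_add_atTop_nat 1)).const_mul x
      exact mem_closure_of_tendsto hlim
        (Eventually.of_forall fun n => ⟨List.replicate (n + 1) 0, by simp, (hw _).symm⟩)
    refine closure_minimal ?_ isClosed_closure
    rintro _ ⟨l, -, rfl⟩
    exact applyWord_mem hinv l h₀

/-- The integers `k` such that `4⁻ⁿ (E + k)` is a subset of the Cantorval `E`. -/
def gnTiles (n : ℕ) : Set ℤ := {k | ∀ z ∈ gnSet, (z + k) / 4 ^ n ∈ gnSet}

lemma gnTiles_succ {n : ℕ} {k : ℤ} (hk : k ∈ gnTiles n) (i : Fin 4) :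
    4 * k + gnDigit i ∈ gnTiles (n + 1) := by
  intro z hz
  convert hk _ (gnMap_mem hz i) using 1
  rw [gnMap_apply]
  push_cast
  field_simp
  ring

lemma exists_gnTiles (n : ℕ) {x : ℝ} (hx : x ∈ gnSet) :
    ∃ k ∈ gnTiles n, 4 ^ n * x - k ∈ gnSet := by
  induction n with
  | zero => exact ⟨0, fun z hz => by simpa using hz, by simpa using hx⟩
  | succ n ih =>
    obtain ⟨k, hk, hz⟩ := ih
    obtain ⟨i, y, hy, hyz⟩ := exists_gnMap_eq hz
    refine ⟨_, gnTiles_succ hk i, ?_⟩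
    convert hy using 1
    rw [gnMap_apply] at hyz
    push_cast
    rw [pow_succ]
    linarith

lemma mem_gnTiles_of_le (n : ℕ) (k : ℤ) (h₁ : 2 * (4 ^ n - 1) ≤ 3 * k) (h₂ : k ≤ 4 ^ n - 1) :
    k ∈ gnTiles n := by
  induction n generalizing k with
  | zero =>
    obtain rfl : k = 0 := by simp at h₁ h₂; omega
    exact fun z hz => by simpa using hz
  | succ n ih =>
    obtain ⟨t, ht⟩ : (3 : ℤ) ∣ 4 ^ n - 1 := by
      simpa using sub_dvd_pow_sub_pow (4 : ℤ) 1 n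
    rw [pow_succ] at h₁ h₂
    generalize (4 : ℤ) ^ n = N at *
    have hk : k % 4 = 0 ∨ k % 4 = 1 ∨ k % 4 = 2 ∨ k % 4 = 3 := by omega
    rcases hk with hk | hk | hk | hk
    · have := gnTiles_succ (ih (k / 4) (by omega) (by omega)) 0
      rwa [show 4 * (k / 4) + gnDigit 0 = k by simp [gnDigit]; omega] at this
    · have := gnTiles_succ (ih (k / 4 - 1) (by omega) (by omega)) 3
      rwa [show 4 * (k / 4 - 1) + gnDigit 3 = k by simp [gnDigit]; omega] at this
    · have := gnTiles_succ (ih (k / 4) (by omega) (by omega)) 1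
      rwa [show 4 * (k / 4) + gnDigit 1 = k by simp [gnDigit]; omega] at this
    · have := gnTiles_succ (ih (k / 4) (by omega) (by omega)) 2
      rwa [show 4 * (k / 4) + gnDigit 2 = k by simp [gnDigit]; omega] at this

lemma exists_lt_four_pow (a : ℝ) {b : ℝ} (hb : 0 < b) : ∃ n : ℕ, a < 4 ^ n * b := by
  obtain ⟨n, hn⟩ := pow_unbounded_of_one_lt (a / b) (by norm_num : (1 : ℝ) < 4)
  exact ⟨n, (div_lt_iff₀ hb).1 hn⟩

lemma Ioo_subset_gnSet : Ioo (2 / 3) 1 ⊆ gnSet := by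
  intro x hx
  rw [← isClosed_gnSet.closure_eq, Metric.mem_closure_iff]
  intro ε hε
  obtain ⟨n, hn⟩ := exists_lt_four_pow 1 (lt_min hε (sub_pos.2 hx.1))
  have hp : (0 : ℝ) < 4 ^ n := by positivity
  have hn₁ : 1 < 4 ^ n * ε := hn.trans_le (by gcongr; exact min_le_left _ _)
  have hf₁ := Int.floor_le (4 ^ n * x)
  have hf₂ := Int.lt_floor_add_one (4 ^ n * x)
  have hn₂ : 1 < 4 ^ n * (x - 2 / 3) := hn.trans_le (by gcongr; exact min_le_right _ _)
  have hk : ⌊4 ^ n * x⌋ ∈ gnTiles n := by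
    apply mem_gnTiles_of_le
    · have : (2 * (4 ^ n - 1) : ℝ) ≤ 3 * ⌊4 ^ n * x⌋ := by linarith
      exact_mod_cast this
    · have : (⌊4 ^ n * x⌋ : ℝ) < 4 ^ n := hf₁.trans_lt (by nlinarith [hx.2])
      have : ⌊4 ^ n * x⌋ < 4 ^ n := by exact_mod_cast this
      omega
  refine ⟨_, hk 0 zero_mem_gnSet, ?_⟩
  rw [zero_add, Real.dist_eq, abs_lt, lt_sub_iff_add_lt, sub_lt_iff_lt_add]
  constructor
  · have : (⌊4 ^ n * x⌋ : ℝ) / 4 ^ n ≤ x := (div_le_iff₀ hp).2 (by linarith)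
    linarith
  · rw [← sub_lt_iff_lt_add', lt_div_iff₀ hp]
    linarith

lemma gnSet_eq_closure_interior : gnSet = closure (interior gnSet) := by
  refine Subset.antisymm (fun x hx => ?_) (isClosed_gnSet.closure_subset_iff.2 interior_subset)
  rw [Metric.mem_closure_iff]
  intro ε hε
  obtain ⟨n, hn⟩ := exists_lt_four_pow 2 hε
  have hp : (0 : ℝ) < 4 ^ n := by positivity
  obtain ⟨k, hk, hz⟩ := exists_gnTiles n hx
  have hz' := gnSet_subset_Icc hz
  have hopen : IsOpen ((fun t : ℝ => 4 ^ n * t - k) ⁻¹' Ioo (2 / 3) 1) :=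
    isOpen_Ioo.preimage (by fun_prop)
  refine ⟨(5 / 6 + k) / 4 ^ n, interior_maximal (fun t ht => ?_) hopen ?_, ?_⟩
  · have := hk _ (Ioo_subset_gnSet ht)
    rwa [sub_add_cancel, mul_div_cancel_left₀ _ hp.ne'] at this
  · rw [mem_preimage, mul_div_cancel₀ _ hp.ne']
    constructor <;> linarith
  · rw [Real.dist_eq, abs_lt, lt_sub_iff_add_lt, sub_lt_iff_lt_add, ← lt_sub_iff_add_lt',
      div_lt_iff₀ hp, ← sub_lt_iff_lt_add', lt_div_iff₀ hp]
    constructor <;> linarith [hz'.1, hz'.2]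

lemma exists_notMem_gnSet_gt_zero {ε : ℝ} (hε : 0 < ε) : ∃ t ∈ Ioo 0 ε, t ∉ gnSet := by
  have key (n : ℕ) : (11 / 24 : ℝ) / 4 ^ n ∉ gnSet := by
    induction n with
    | zero =>
      intro h
      obtain ⟨i, y, hy, hyx⟩ := exists_gnMap_eq h
      have hy' := gnSet_subset_Icc hy
      rw [gnMap_apply] at hyx
      fin_cases i <;> simp [gnDigit] at hyx <;> linarith [hy'.1, hy'.2]
    | succ n ih =>
      intro h
      obtain ⟨i, y, hy, hyx⟩ := exists_gnMap_eq h
      have hy' := gnSet_subset_Icc hy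
      rw [gnMap_apply, pow_succ, ← div_div] at hyx
      have hle : (11 / 24 : ℝ) / 4 ^ n ≤ 11 / 24 :=
        div_le_self (by norm_num) (one_le_pow₀ (by norm_num))
      generalize (11 / 24 : ℝ) / 4 ^ n = a at *
      fin_cases i <;> simp [gnDigit] at hyx
      · exact ih (hyx ▸ hy)
      all_goals linarith [hy'.1]
  obtain ⟨n, hn⟩ := exists_lt_four_pow (11 / 24) hε
  exact ⟨_, ⟨by positivity, (div_lt_iff₀ (by positivity)).2 (by linarith)⟩, key n⟩

/-- The left endpoint of a gap is approximated from the left by points outside the Cantorval. -/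
lemma exists_notMem_gnSet_lt_of_gap {p q : ℝ} (hp : p ∈ gnSet) (hpq : p < q)
    (hgap : ∀ t ∈ gnSet, t < q → t ≤ p) {ε : ℝ} (hε : 0 < ε) :
    ∃ t ∈ Ioo (p - ε) p, t ∉ gnSet := by
  obtain ⟨n, hn⟩ := exists_lt_four_pow (5 / 3) (sub_pos.2 hpq)
  have h4 : (0 : ℝ) < 4 ^ n := by positivity
  have hend {t : ℝ} {k : ℤ} (ht : t ≤ p) (hk : k ∈ gnTiles n) (hz : 4 ^ n * t - k ∈ gnSet) :
      5 / 3 + (k : ℝ) ≤ 4 ^ n * p := by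
    have h := hgap _ (hk _ five_thirds_mem_gnSet) <| by
      rw [div_lt_iff₀ h4]
      nlinarith [(gnSet_subset_Icc hz).1]
    rw [div_le_iff₀ h4] at h
    linarith
  obtain ⟨k, hk, hz⟩ := exists_gnTiles n hp
  have hkp : 4 ^ n * p = k + 5 / 3 := by
    linarith [hend le_rfl hk hz, (gnSet_subset_Icc hz).2]
  obtain ⟨s, hs, hsE⟩ := exists_notMem_gnSet_gt_zero (lt_min one_pos (mul_pos h4 hε))
  have hs₁ : s < 1 := hs.2.trans_le (min_le_left _ _)
  have hs₂ : s < 4 ^ n * ε := hs.2.trans_le (min_le_right _ _)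
  have ht : 4 ^ n * (p - s / 4 ^ n) = k + 5 / 3 - s := by
    rw [mul_sub, mul_div_cancel₀ _ h4.ne', hkp]
  have htp : p - s / 4 ^ n < p := sub_lt_self _ (div_pos hs.1 h4)
  refine ⟨p - s / 4 ^ n, ⟨?_, htp⟩, fun htE => ?_⟩
  · have : s / 4 ^ n < ε := (div_lt_iff₀ h4).2 (by linarith)
    linarith
  · obtain ⟨k', hk', hz'⟩ := exists_gnTiles n htE
    have h₁ := hend htp.le hk' hz'
    have h₂ := (gnSet_subset_Icc hz').2
    rw [ht] at h₂ hz'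
    obtain rfl : k' = k := by
      have h₃ : (k' : ℝ) ≤ k := by linarith
      have h₄ : (k : ℝ) < k' + 1 := by linarith
      norm_cast at h₃ h₄
      omega
    refine hsE (reflect_mem_gnSet_iff.1 ?_)
    convert hz' using 1
    ring

/-- Points of the Cantorval approximated from both sides by points outside of it. -/
def gnIsolated : Set ℝ :=
  {p | p ∈ gnSet ∧ ∀ ε > 0, (∃ t ∈ Ioo (p - ε) p, t ∉ gnSet) ∧ ∃ t ∈ Ioo p (p + ε), t ∉ gnSet}

lemma reflect_mem_gnIsolated {p : ℝ} (hp : p ∈ gnIsolated) : 5 / 3 - p ∈ gnIsolated := by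
  refine ⟨reflect_mem_gnSet hp.1, fun ε hε => ?_⟩
  obtain ⟨⟨s, hs, hsE⟩, t, ht, htE⟩ := hp.2 ε hε
  exact ⟨⟨5 / 3 - t, ⟨by linarith [ht.2], by linarith [ht.1]⟩, mt reflect_mem_gnSet_iff.1 htE⟩,
    5 / 3 - s, ⟨by linarith [hs.2], by linarith [hs.1]⟩, mt reflect_mem_gnSet_iff.1 hsE⟩

lemma connectedComponentIn_of_mem_gnIsolated {p : ℝ} (hp : p ∈ gnIsolated) :
    connectedComponentIn gnSet p = {p} := by
  have hpC := mem_connectedComponentIn hp.1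
  have hord := (isPreconnected_connectedComponentIn (F := gnSet) (x := p)).ordConnected
  refine Subset.antisymm (fun z hz => ?_) (singleton_subset_iff.2 hpC)
  by_contra hne
  rcases lt_or_gt_of_ne hne with h | h
  · obtain ⟨⟨t, ht, htE⟩, -⟩ := hp.2 (p - z) (sub_pos.2 h)
    exact htE (connectedComponentIn_subset _ _
      (hord.out hz hpC ⟨by linarith [ht.1], ht.2.le⟩))
  · obtain ⟨-, t, ht, htE⟩ := hp.2 (z - p) (sub_pos.2 h)
    exact htE (connectedComponentIn_subset _ _
      (hord.out hpC hz ⟨ht.1.le, by linarith [ht.2]⟩))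

lemma exists_gnIsolated_gt {w z : ℝ} (hwz : w < z) (hsub : Icc w z ⊆ gnSet)
    (hz : ∀ ε > 0, ∃ t ∈ Ioo z (z + ε), t ∉ gnSet) {ε : ℝ} (hε : 0 < ε) :
    ∃ p ∈ gnIsolated, p ∈ Ioo z (z + ε) := by
  obtain ⟨y, hy, hyE⟩ := hz ε hε
  have hzE : z ∈ gnSet := hsub ⟨hwz.le, le_rfl⟩
  obtain ⟨p, ⟨hpE, hzp, hpy⟩, hmax⟩ :=
    (isCompact_gnSet.inter_right isClosed_Icc).exists_isGreatest
      (⟨z, hzE, le_rfl, hy.1.le⟩ : (gnSet ∩ Icc z y).Nonempty)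
  have hpy' : p < y := hpy.lt_of_ne fun h => hyE (h ▸ hpE)
  have hgap : ∀ t ∈ gnSet, t < y → t ≤ p := fun t ht hty => by
    rcases le_total t z with h | h
    · exact h.trans hzp
    · exact hmax ⟨ht, h, hty.le⟩
  have hiso : p ∈ gnIsolated := by
    refine ⟨hpE, fun δ hδ => ⟨exists_notMem_gnSet_lt_of_gap hpE hpy' hgap hδ, ?_⟩⟩
    obtain ⟨t, ht₁, ht₂⟩ := exists_between (lt_min hpy' (lt_add_of_pos_right p hδ))
    exact ⟨t, ⟨ht₁, ht₂.trans_le (min_le_right _ _)⟩,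
      fun ht => (hgap t ht (ht₂.trans_le (min_le_left _ _))).not_gt ht₁⟩
  refine ⟨p, hiso, hzp.lt_of_ne ?_, hpy'.trans hy.2⟩
  rintro rfl
  obtain ⟨⟨t, ht, htE⟩, -⟩ := hiso.2 (z - w) (sub_pos.2 hwz)
  exact htE (hsub ⟨by linarith [ht.1], ht.2.le⟩)

lemma exists_gnIsolated_lt {w z : ℝ} (hzw : z < w) (hsub : Icc z w ⊆ gnSet)
    (hz : ∀ ε > 0, ∃ t ∈ Ioo (z - ε) z, t ∉ gnSet) {ε : ℝ} (hε : 0 < ε) :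
    ∃ p ∈ gnIsolated, p ∈ Ioo (z - ε) z := by
  obtain ⟨p, hp, hpz⟩ := exists_gnIsolated_gt (w := 5 / 3 - w) (z := 5 / 3 - z) (by linarith)
    (fun t ht => reflect_mem_gnSet_iff.1 (hsub ⟨by linarith [ht.2], by linarith [ht.1]⟩))
    (fun δ hδ => by
      obtain ⟨t, ht, htE⟩ := hz δ hδ
      exact ⟨5 / 3 - t, ⟨by linarith [ht.2], by linarith [ht.1]⟩,
        mt reflect_mem_gnSet_iff.1 htE⟩) hε
  exact ⟨5 / 3 - p, reflect_mem_gnIsolated hp, by linarith [hpz.2], by linarith [hpz.1]⟩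

lemma isSymmetricCantorval_gnSet : IsSymmetricCantorval gnSet := by
  refine ⟨⟨0, zero_mem_gnSet⟩, isCompact_gnSet, gnSet_eq_closure_interior, fun x hx hnt z hz => ?_⟩
  set C := connectedComponentIn gnSet x with hC
  have hCE : C ⊆ gnSet := connectedComponentIn_subset _ _
  have hpre : IsPreconnected C := isPreconnected_connectedComponentIn
  have hxC : x ∈ C := mem_connectedComponentIn hx
  have hmax {s : Set ℝ} (hs : IsPreconnected s) (hsE : s ⊆ gnSet) (hsC : (C ∩ s).Nonempty) :
      s ⊆ C := by
    obtain ⟨y, hyC, hys⟩ := hsC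
    rw [hC, connectedComponentIn_eq hyC]
    exact hs.subset_connectedComponentIn hys hsE
  have hzC : z ∈ C := hmax hpre.closure (closure_minimal hCE isClosed_gnSet)
    ⟨x, hxC, subset_closure hxC⟩ hz.1
  have hord := hpre.ordConnected
  obtain ⟨w, hwC, hwz⟩ : ∃ w ∈ C, w ≠ z := by
    by_contra! h
    exact hnt fun a ha b hb => (h a ha).trans (h b hb).symm
  have hout : ∀ ε > 0, ∃ t ∈ Ioo (z - ε) (z + ε), t ∉ C := fun ε hε => by
    by_contra! h
    exact hz.2 (interior_maximal h isOpen_Ioo ⟨by linarith, by linarith⟩)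
  rw [accPt_iff_nhds]
  intro U hU
  obtain ⟨ε, hε, hεU⟩ := Metric.mem_nhds_iff.1 hU
  rw [Real.ball_eq_Ioo] at hεU
  rcases lt_or_gt_of_ne hwz with h | h
  · have hsub : Icc w z ⊆ gnSet := (hord.out hwC hzC).trans hCE
    obtain ⟨p, hp, hpz⟩ := exists_gnIsolated_gt h hsub (fun δ hδ => by
      by_contra! hall
      obtain ⟨t, ht, htC⟩ := hout (min δ (z - w)) (lt_min hδ (sub_pos.2 h))
      have h₁ := min_le_left δ (z - w)
      have h₂ := min_le_right δ (z - w)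
      have hIco : Ico z (z + δ) ⊆ C := by
        refine hmax isPreconnected_Ico (fun s hs => ?_) ⟨z, hzC, le_rfl, by linarith⟩
        rcases hs.1.eq_or_lt with rfl | hs'
        · exact hCE hzC
        · exact hall s ⟨hs', hs.2⟩
      rcases le_total t z with htz | htz
      · exact htC (hord.out hwC hzC ⟨by linarith [ht.1], htz⟩)
      · exact htC (hIco ⟨htz, by linarith [ht.2]⟩)) hε
    exact ⟨p, ⟨hεU ⟨by linarith [hpz.1], hpz.2⟩, hp.1,
      connectedComponentIn_of_mem_gnIsolated hp⟩, hpz.1.ne'⟩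
  · have hsub : Icc z w ⊆ gnSet := (hord.out hzC hwC).trans hCE
    obtain ⟨p, hp, hpz⟩ := exists_gnIsolated_lt h hsub (fun δ hδ => by
      by_contra! hall
      obtain ⟨t, ht, htC⟩ := hout (min δ (w - z)) (lt_min hδ (sub_pos.2 h))
      have h₁ := min_le_left δ (w - z)
      have h₂ := min_le_right δ (w - z)
      have hIoc : Ioc (z - δ) z ⊆ C := by
        refine hmax isPreconnected_Ioc (fun s hs => ?_) ⟨z, hzC, by linarith, le_rfl⟩
        rcases hs.2.eq_or_lt with rfl | hs'
        · exact hCE hzC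
        · exact hall s ⟨hs.1, hs'⟩
      rcases le_total z t with htz | htz
      · exact htC (hord.out hzC hwC ⟨htz, by linarith [ht.2]⟩)
      · exact htC (hIoc ⟨by linarith [ht.1], htz⟩)) hε
    exact ⟨p, ⟨hεU ⟨hpz.1, by linarith [hpz.2]⟩, hp.1,
      connectedComponentIn_of_mem_gnIsolated hp⟩, hpz.2.ne⟩

/-! ### The circle as the one-point compactification of the line -/

/-- A homeomorphism between the one-point compactification of the line and the circle. -/
noncomputable def onePointRealHomeomorphS1 : OnePoint ℝ ≃ₜ S1 :=
  (onePointEquivSphereOfFinrankEq (ι := Fin 2) (V := ℝ) (by simp)).trans <|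
    (Complex.orthonormalBasisOneI.repr.symm.toHomeomorph.subtype fun x => by
      change x ∈ Metric.sphere 0 1 ↔ Complex.orthonormalBasisOneI.repr.symm x ∈ Metric.sphere 0 1
      rw [mem_sphere_zero_iff_norm, mem_sphere_zero_iff_norm, LinearIsometryEquiv.norm_map]).trans
      (AddCircle.homeomorphCircle (one_ne_zero (α := ℝ))).symm

theorem stmt19 : ∃ (n : ℕ) (f : Fin n → (S1 ≃ₜ S1)) (M : Set S1),
    (∀ i, ∃ x : S1, f i x = x) ∧
    IsMinimalIFS (fun i (x : S1) => f i x) M ∧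
    IsSymmetricCantorval M := by
  set φ := onePointRealHomeomorphS1
  have he : IsOpenEmbedding fun x : ℝ => φ (x : OnePoint ℝ) :=
    φ.isOpenEmbedding.comp OnePoint.isOpenEmbedding_coe
  refine ⟨4, fun i => φ.symm.trans ((gnMap i).onePointCongr.trans φ),
    (fun x : ℝ => φ (x : OnePoint ℝ)) '' gnSet, fun i => ⟨φ OnePoint.infty, ?_⟩,
    isMinimalIFS_gnSet.image he.continuous (fun i x => ?_) isCompact_gnSet,
    isSymmetricCantorval_gnSet.image he⟩
  · simp only [Homeomorph.trans_apply, Homeomorph.symm_apply_apply]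
    rfl
  · simp only [Homeomorph.trans_apply, Homeomorph.symm_apply_apply]
    rfl
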